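/- arXiv:1904.00626 — 2 statements merged into one kernel-verified Lean document; each statement's English description precedes it below -/
import Mathlib

section
/- Let θ ∈ (ℝ/2πℤ)^N be such that all pairwise phase differences θ_j − θ_k for j ≠ k are distinct (as elements of ℝ/2πℤ). Then for every directed graph H on vertices {1,…,N} without self-loops, there exists a 2π-periodic coupling function g (which may be taken smooth) such that the effective coupling graph of the all-to-all network at θ equals H, i.e., for all j ≠ k: θ_j − θ_k ∉ DZ(g) if and only if (j,k) ∈ E(H). -/
open Real Set

/-- The dead zone of a coupling function: the set of points at which `g` is locally zero. -/
def DZ (g : ℝ → ℝ) : Set ℝ := {x | ∃ U : Set ℝ, IsOpen U ∧ x ∈ U ∧ ∀ y ∈ U, g y = 0}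

/-- if all pairwise phase differences of θ are distinct modulo 2π, then every
directed graph H without self-loops is realised as the effective coupling graph at θ for a
suitable smooth 2π-periodic coupling function. -/
theorem realise_any_graph (N : ℕ) (θ : Fin N → ℝ)
    (hdist : ∀ j k j' k' : Fin N, j ≠ k → j' ≠ k' → (j, k) ≠ (j', k') →
      ∀ mz : ℤ, (θ j - θ k) - (θ j' - θ k') ≠ 2 * Real.pi * mz)
    (H : Fin N → Fin N → Prop) (hH : ∀ i, ¬ H i i) :
    ∃ g : ℝ → ℝ, Function.Periodic g (2 * Real.pi) ∧ ContDiff ℝ (⊤ : ℕ∞) g ∧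
      ∀ j k : Fin N, j ≠ k → (θ j - θ k ∉ DZ g ↔ H j k) := by 
  classical
  let d : Fin N × Fin N → ℝ := fun p => θ p.1 - θ p.2
  have hc : ∀ᶠ c in nhdsWithin (1 : ℝ) (Iio 1), ∀ p q : Fin N × Fin N,
      p.1 ≠ p.2 → q.1 ≠ q.2 → p ≠ q → Real.cos (d p - d q) < c := by
    rw [Filter.eventually_all]
    intro p
    rw [Filter.eventually_all]
    intro q
    by_cases h : p.1 ≠ p.2 ∧ q.1 ≠ q.2 ∧ p ≠ q
    · have hlt : Real.cos (d p - d q) < 1 := by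
        refine lt_of_le_of_ne (Real.cos_le_one _) ?_
        intro h1
        obtain ⟨n, hn⟩ := (Real.cos_eq_one_iff _).1 h1
        refine hdist p.1 p.2 q.1 q.2 h.1 h.2.1 h.2.2 n ?_
        change d p - d q = _
        rw [← hn]; ring
      filter_upwards [Ioo_mem_nhdsLT hlt] with c hc _ _ _
      exact hc.1
    · exact Filter.Eventually.of_forall fun c h1 h2 h3 => absurd ⟨h1, h2, h3⟩ h
  obtain ⟨c, hc, hc1⟩ := (hc.and self_mem_nhdsWithin).exists
  replace hc1 : c < 1 := hc1
  let E : Finset (Fin N × Fin N) := Finset.univ.filter fun p => H p.1 p.2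
  have hE : ∀ p, p ∈ E ↔ H p.1 p.2 := fun p => by simp [E]
  refine ⟨fun x => ∑ p ∈ E, expNegInvGlue (Real.cos (x - d p) - c), ?_, ?_, ?_⟩
  · intro x
    refine Finset.sum_congr rfl fun p _ => ?_
    rw [add_sub_right_comm, Real.cos_add_two_pi]
  · refine ContDiff.sum fun p _ => ?_
    exact expNegInvGlue.contDiff.comp
      ((Real.contDiff_cos.comp (contDiff_id.sub contDiff_const)).sub contDiff_const)
  · intro j k hjk
    constructor
    · intro h
      by_contra hn
      apply h
      refine ⟨⋂ p ∈ E, {y | Real.cos (y - d p) < c}, ?_, ?_, ?_⟩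
      · refine isOpen_biInter_finset fun p _ => ?_
        exact isOpen_lt (by fun_prop) continuous_const
      · simp only [mem_iInter, mem_setOf_eq]
        intro p hp
        rw [hE] at hp
        refine hc (j, k) p hjk (fun h => hH p.2 (by rwa [h] at hp)) ?_
        rintro rfl
        exact hn hp
      · intro y hy
        simp only [mem_iInter, mem_setOf_eq] at hy
        exact Finset.sum_eq_zero fun p hp =>
          expNegInvGlue.zero_of_nonpos (by linarith [hy p hp])
    · rintro hh ⟨U, -, hx, hU⟩
      have h0 := hU _ hx
      have hpos : 0 < ∑ p ∈ E, expNegInvGlue (Real.cos (θ j - θ k - d p) - c) := by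
        refine Finset.sum_pos' (fun p _ => expNegInvGlue.nonneg _) ⟨(j, k), (hE _).2 hh, ?_⟩
        apply expNegInvGlue.pos_of_pos
        simp [d, hc1]
      exact hpos.ne' h0
end

section
/- There exists a single 2π-periodic smooth coupling function g such that for every directed graph H on vertices {1,…,N} without self-loops there exists a point θ = θ(H) ∈ (ℝ/2πℤ)^N with effective coupling graph at θ equal to H. -/
open Real Set

theorem aux_lt {a d c b : ℕ} (had : d ≤ a) (hac : a < c) : (3:ℕ)^a + 3^d < 3^c + 3^b := by
  have h1 : (3:ℕ)^d ≤ 3^a := Nat.pow_le_pow_right (by norm_num) had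
  have h2 : (3:ℕ)^(a+1) ≤ 3^c := Nat.pow_le_pow_right (by norm_num) hac
  have h3 : 0 < (3:ℕ)^b := by positivity
  have h4 : 0 < (3:ℕ)^a := by positivity
  rw [pow_succ] at h2
  omega

theorem aux_sorted {a d c b : ℕ} (had : d ≤ a) (hcb : b ≤ c) (h : (3:ℕ)^a + 3^d = 3^c + 3^b) :
    a = c ∧ d = b := by
  have hac : a = c := by
    rcases lt_trichotomy a c with h1 | h1 | h1
    · exact absurd h (aux_lt had h1).ne
    · exact h1
    · exact absurd h (aux_lt hcb h1).ne'
  subst hac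
  exact ⟨rfl, Nat.pow_right_injective (le_refl 2 |>.trans (by norm_num)) (Nat.add_left_cancel h)⟩

theorem aux_diff {a b c d : ℕ} (hab : a ≠ b) (h : (3:ℤ)^a - 3^b = 3^c - 3^d) :
    a = c ∧ b = d := by
  have h' : (3:ℕ)^a + 3^d = 3^c + 3^b := by
    zify
    linarith
  rcases le_total d a with h1 | h1 <;> rcases le_total b c with h2 | h2
  · have := aux_sorted h1 h2 h'
    omega
  · have := aux_sorted h1 h2 (by omega)
    omega
  · have := aux_sorted h1 h2 (by omega)
    omega
  · have := aux_sorted h1 h2 (by omega)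
    omega

theorem aux_cos (m : ℤ) (h : Real.cos m = 1) : m = 0 := by
  obtain ⟨n, hn⟩ := (Real.cos_eq_one_iff _).1 h
  by_cases h0 : n = 0
  · subst h0
    simpa using hn.symm
  · exfalso
    refine irrational_pi ⟨(m : ℚ) / (2 * n), ?_⟩
    have : (n:ℝ) ≠ 0 := by exact_mod_cast h0
    push_cast
    rw [← hn]
    field_simp

/-- a single smooth 2π-periodic coupling function realises every directed graph
on {1,…,N} without self-loops as an effective coupling graph at some point. -/
theorem one_g_realises_all (N : ℕ) :
    ∃ g : ℝ → ℝ, Function.Periodic g (2 * Real.pi) ∧ ContDiff ℝ (⊤ : ℕ∞) g ∧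
      ∀ H : Fin N → Fin N → Prop, (∀ i, ¬ H i i) →
        ∃ θ : Fin N → ℝ, ∀ j k : Fin N, j ≠ k → (θ j - θ k ∉ DZ g ↔ H j k) := by
  classical
  obtain ⟨e, he⟩ := exists_injective_nat ((Fin N → Fin N → Prop) × Fin N)
  let T := (Fin N → Fin N → Prop) × Fin N × Fin N
  let D : T → ℤ := fun t => 3 ^ e (t.1, t.2.1) - 3 ^ e (t.1, t.2.2)
  let A := {t : T // t.2.1 ≠ t.2.2 ∧ t.1 t.2.1 t.2.2}
  let B := {t : T // t.2.1 ≠ t.2.2 ∧ ¬ t.1 t.2.1 t.2.2}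
  have : Fintype A := Fintype.ofFinite A
  have hlt : ∀ (b : B) (a : A), Real.cos ((D b.1 : ℝ) - D a.1) < 1 := by
    rintro ⟨⟨H', j', k'⟩, hb1, hb2⟩ ⟨⟨H, j, k⟩, ha1, ha2⟩
    refine lt_of_le_of_ne (Real.cos_le_one _) fun h => ?_
    have h0 := aux_cos (D (H', j', k') - D (H, j, k)) (by push_cast; exact h)
    have hne : e (H', j') ≠ e (H', k') := fun h => hb1 (by simpa using he h)
    obtain ⟨h1, h2⟩ := aux_diff hne (sub_eq_zero.1 h0)
    have h3 : (H', j') = (H, j) := he h1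
    have h4 : (H', k') = (H, k) := he h2
    simp only [Prod.mk.injEq] at h3 h4
    apply hb2
    change H' j' k'
    rw [h3.1, h3.2, h4.2]
    exact ha2
  have hc : ∃ c : ℝ, c < 1 ∧ ∀ (b : B) (a : A), Real.cos ((D b.1 : ℝ) - D a.1) < c := by
    have h1 : ∀ᶠ c in nhdsWithin (1:ℝ) (Iio 1),
        ∀ (b : B) (a : A), Real.cos ((D b.1 : ℝ) - D a.1) < c := by
      simp only [Filter.eventually_all]
      intro b a
      exact nhdsWithin_le_nhds (lt_mem_nhds (hlt b a))
    obtain ⟨c, h2, h3⟩ := (h1.and self_mem_nhdsWithin).exists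
    exact ⟨c, h3, h2⟩
  obtain ⟨c, hc1, hc⟩ := hc
  refine ⟨fun x => ∑ a : A, expNegInvGlue (Real.cos (x - D a.1) - c), ?_, ?_, ?_⟩
  · intro x
    simp only [add_sub_right_comm, Real.cos_add_two_pi]
  · refine ContDiff.sum fun a _ => ?_
    refine expNegInvGlue.contDiff.comp ?_
    exact (Real.contDiff_cos.comp (contDiff_id.sub contDiff_const)).sub contDiff_const
  · intro H _
    refine ⟨fun j => 3 ^ e (H, j), fun j k hjk => ?_⟩
    have hD : (3:ℝ) ^ e (H, j) - 3 ^ e (H, k) = (D (H, j, k) : ℝ) := by simp [D]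
    simp only [hD]
    constructor
    · intro hz
      by_contra hH
      apply hz
      refine ⟨{x | ∀ a : A, Real.cos (x - D a.1) < c}, ?_, ?_, ?_⟩
      · simp only [ofPred_forall]
        exact isOpen_iInter_of_finite fun a => isOpen_lt (by fun_prop) continuous_const
      · exact fun a => hc ⟨(H, j, k), hjk, hH⟩ a
      · intro y hy
        exact Finset.sum_eq_zero fun a _ => expNegInvGlue.zero_of_nonpos (by linarith [hy a])
    · rintro hH ⟨U, -, hx, hU⟩
      have h0 := hU _ hx
      have h1 := (Finset.sum_eq_zero_iff_of_nonneg
        (fun a _ => expNegInvGlue.nonneg _)).1 h0 ⟨(H, j, k), hjk, hH⟩ (Finset.mem_univ _)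
      have h2 : 0 < expNegInvGlue (Real.cos ((D (H, j, k) : ℝ) - D (H, j, k)) - c) :=
        expNegInvGlue.pos_of_pos (by simpa using hc1)
      exact h2.ne' h1
end
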